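/- Let G = SL(2,ℝ), Γ the image of SL(2,ℤ) in G, and u(t) = [[1,t],[0,1]]. Let a ∈ G/Γ be a point whose u-orbit is not periodic (there is no t > 0 with u(t)·a = a). Then for every Borel probability measure ν on G/Γ that is invariant under left translation by every element of G, and for every continuous compactly supported function f : G/Γ → ℝ, the time averages (1/T)·∫₀ᵀ f(u(t)·a) dt converge to ∫ f dν as T → ∞; in other words, every nonperiodic horocycle orbit is uniformly distributed with respect to the G-invariant probability measure on G/Γ. -/

import Mathlib

open Matrix MatrixGroups Filter MeasureTheory Topology

noncomputable instance {n : ℕ} : TopologicalSpace (Matrix.SpecialLinearGroup (Fin n) ℝ) :=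
  instTopologicalSpaceSubtype

noncomputable instance {n : ℕ} : MeasurableSpace (Matrix.SpecialLinearGroup (Fin n) ℝ) :=
  borel _

instance {n : ℕ} : BorelSpace (Matrix.SpecialLinearGroup (Fin n) ℝ) := ⟨rfl⟩

/-- The image of `SL(2,ℤ)` in `SL(2,ℝ)`. -/
def SLZ2 : Subgroup (SL(2, ℝ)) :=
  (Matrix.SpecialLinearGroup.map (n := Fin 2) (Int.castRingHom ℝ)).range

/-- The horocycle one-parameter subgroup `u(t) = [[1,t],[0,1]]` of `SL(2,ℝ)`. -/
def horocycle (t : ℝ) : SL(2, ℝ) :=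
  ⟨!![1, t; 0, 1], by simp [Matrix.det_fin_two_of]⟩


abbrev GG := SL(2, ℝ)
abbrev XX := SL(2, ℝ) ⧸ SLZ2

lemma val_isClosedEmbedding : IsClosedEmbedding (fun g : GG => (g : Matrix (Fin 2) (Fin 2) ℝ)) :=
  Matrix.SpecialLinearGroup.isClosedEmbedding_val

instance instTG : IsTopologicalGroup GG := Matrix.SpecialLinearGroup.topologicalGroup

instance instT2 : T2Space GG := val_isClosedEmbedding.isEmbedding.t2Space
instance instSC : SecondCountableTopology GG :=
  haveI : SecondCountableTopology (Matrix (Fin 2) (Fin 2) ℝ) :=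
    inferInstanceAs (SecondCountableTopology (Fin 2 → Fin 2 → ℝ))
  val_isClosedEmbedding.isEmbedding.secondCountableTopology
instance instLC : LocallyCompactSpace GG :=
  haveI : LocallyCompactSpace (Matrix (Fin 2) (Fin 2) ℝ) :=
    inferInstanceAs (LocallyCompactSpace (Fin 2 → Fin 2 → ℝ))
  val_isClosedEmbedding.locallyCompactSpace
instance instDisc : DiscreteTopology SLZ2 :=
  Matrix.SpecialLinearGroup.discreteSpecialLinearGroupIntRangeSL
instance instClosed : IsClosed (SLZ2 : Set GG) := Subgroup.isClosed_of_discrete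

/-- matrix with given entries -/
def mat (a b c d : ℝ) (h : a * d - b * c = 1) : GG :=
  ⟨!![a, b; c, d], by rw [Matrix.det_fin_two_of]; exact h⟩

/-- diagonal -/
noncomputable def dg (τ : ℝ) : GG :=
  mat (Real.exp τ) 0 0 (Real.exp (-τ)) (by rw [← Real.exp_add]; simp)

/-- lower unipotent -/
def lo (c : ℝ) : GG := mat 1 0 c 1 (by simp)

lemma det_GG (g : GG) : g 0 0 * g 1 1 - g 0 1 * g 1 0 = 1 := by
  have := g.2
  rwa [Matrix.det_fin_two] at this

lemma GG_ext {g h : GG} (h00 : g 0 0 = h 0 0) (h01 : g 0 1 = h 0 1) (h10 : g 1 0 = h 1 0)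
    (h11 : g 1 1 = h 1 1) : g = h := by
  apply Matrix.SpecialLinearGroup.ext
  intro i j
  fin_cases i <;> fin_cases j <;> assumption

lemma mul00 (g h : GG) : (g * h) 0 0 = g 0 0 * h 0 0 + g 0 1 * h 1 0 := by
  simp [Matrix.SpecialLinearGroup.coe_mul, Matrix.mul_apply]
lemma mul01 (g h : GG) : (g * h) 0 1 = g 0 0 * h 0 1 + g 0 1 * h 1 1 := by
  simp [Matrix.SpecialLinearGroup.coe_mul, Matrix.mul_apply]
lemma mul10 (g h : GG) : (g * h) 1 0 = g 1 0 * h 0 0 + g 1 1 * h 1 0 := by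
  simp [Matrix.SpecialLinearGroup.coe_mul, Matrix.mul_apply]
lemma mul11 (g h : GG) : (g * h) 1 1 = g 1 0 * h 0 1 + g 1 1 * h 1 1 := by
  simp [Matrix.SpecialLinearGroup.coe_mul, Matrix.mul_apply]

section
variable (a b c d : ℝ) (h : a * d - b * c = 1)
lemma mat00 : (mat a b c d h) 0 0 = a := rfl
lemma mat01 : (mat a b c d h) 0 1 = b := rfl
lemma mat10 : (mat a b c d h) 1 0 = c := rfl
lemma mat11 : (mat a b c d h) 1 1 = d := rfl
end
lemma horo_eq (t : ℝ) : horocycle t = mat 1 t 0 1 (by simp) := rfl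

lemma continuous_toGG {Y : Type*} [TopologicalSpace Y] {F : Y → GG}
    (h : ∀ i j, Continuous fun y => F y i j) : Continuous F :=
  continuous_induced_rng.2 (continuous_matrix h)

lemma continuous_entry (i j : Fin 2) : Continuous fun g : GG => g i j :=
  (continuous_apply_apply i j).comp continuous_induced_dom

lemma continuous_toGG' {Y : Type*} [TopologicalSpace Y] {F : Y → GG}
    (h00 : Continuous fun y => F y 0 0) (h01 : Continuous fun y => F y 0 1)
    (h10 : Continuous fun y => F y 1 0) (h11 : Continuous fun y => F y 1 1) : Continuous F := by
  apply continuous_toGG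
  intro i j
  fin_cases i <;> fin_cases j <;> assumption

lemma continuous_horocycle : Continuous horocycle := by
  apply continuous_toGG' <;> simp only [horo_eq, mat00, mat01, mat10, mat11] <;> fun_prop

lemma continuous_lo : Continuous lo := by
  apply continuous_toGG' <;> simp only [lo, mat00, mat01, mat10, mat11] <;> fun_prop

lemma one00 : (1 : GG) 0 0 = 1 := by simp
lemma one01 : (1 : GG) 0 1 = 0 := by simp
lemma one10 : (1 : GG) 1 0 = 0 := by simp
lemma one11 : (1 : GG) 1 1 = 1 := by simp

lemma horo_add (s t : ℝ) : horocycle (s + t) = horocycle s * horocycle t := by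
  apply GG_ext <;> simp only [mul00, mul01, mul10, mul11, horo_eq, mat00, mat01, mat10, mat11] <;>
    ring

lemma horo_zero : horocycle 0 = 1 := by
  apply GG_ext <;> simp only [one00, one01, one10, one11, horo_eq, mat00, mat01, mat10, mat11]

lemma lo_zero : lo 0 = 1 := by
  apply GG_ext <;> simp only [one00, one01, one10, one11, lo, mat00, mat01, mat10, mat11]

lemma dg_zero : dg 0 = 1 := by
  apply GG_ext <;> simp only [one00, one01, one10, one11, dg, mat00, mat01, mat10, mat11] <;> simp

lemma dg_add (s t : ℝ) : dg (s + t) = dg s * dg t := by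
  apply GG_ext <;> simp only [mul00, mul01, mul10, mul11, dg, mat00, mat01, mat10, mat11] <;>
    simp [← Real.exp_add, add_comm]

lemma dg_mul_neg (s : ℝ) : dg s * dg (-s) = 1 := by rw [← dg_add, add_neg_cancel, dg_zero]
lemma dg_neg_mul (s : ℝ) : dg (-s) * dg s = 1 := by rw [← dg_add, neg_add_cancel, dg_zero]

lemma exp_two_mul' (τ : ℝ) : Real.exp (2 * τ) = Real.exp τ * Real.exp τ := by
  rw [← Real.exp_add]; ring_nf

lemma exp_mul_neg (τ : ℝ) : Real.exp τ * Real.exp (-τ) = 1 := by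
  rw [← Real.exp_add]; simp

lemma dg_horo (τ r : ℝ) : dg τ * horocycle r = horocycle (Real.exp (2 * τ) * r) * dg τ := by
  have h1 := exp_mul_neg τ
  apply GG_ext <;> simp only [mul00, mul01, mul10, mul11, dg, horo_eq, mat00, mat01, mat10, mat11,
    exp_two_mul']
  all_goals first | ring1 | linear_combination -(Real.exp τ * r) * h1

section Mautner
variable {H : Type*} [NormedAddCommGroup H] [InnerProductSpace ℝ H]

lemma w_decomp (g : GG) (hc : g 1 0 ≠ 0) :
    g = horocycle (g 0 0 / g 1 0) *
      mat 0 (-(g 1 0)⁻¹) (g 1 0) 0 (by field_simp; simp) * horocycle (g 1 1 / g 1 0) := by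
  have hd := det_GG g
  apply GG_ext <;> simp only [mul00, mul01, mul10, mul11, horo_eq, mat00, mat01, mat10, mat11]
  · field_simp; ring
  · field_simp; linear_combination -hd
  · ring
  · field_simp; ring

lemma mautner (ρ : GG → H → H) (hmul : ∀ g h v, ρ (g * h) v = ρ g (ρ h v))
    (h1 : ∀ v, ρ 1 v = v) (hin : ∀ g v w, inner ℝ (ρ g v) (ρ g w) = inner ℝ v w)
    (hcont : ∀ v, Continuous fun g => ρ g v) (v : H) (hv : ∀ t, ρ (horocycle t) v = v) :
    ∀ g, ρ g v = v := by
  set φ : GG → ℝ := fun g => inner ℝ (ρ g v) v with hφ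
  have hφc : Continuous φ := (hcont v).inner continuous_const
  have hφ1 : φ 1 = inner ℝ v v := by simp only [hφ, h1]
  have hfix : ∀ g, φ g = φ 1 → ρ g v = v := by
    intro g hg
    rw [← sub_eq_zero, ← inner_self_eq_zero (𝕜 := ℝ), inner_sub_left, inner_sub_right,
      inner_sub_right, hin, real_inner_comm (ρ g v) v]
    have : inner ℝ (ρ g v) v = inner ℝ v v := by rw [← hφ1, ← hg]
    rw [this]; ring
  have hbi : ∀ h h' g, ρ h v = v → ρ h' v = v → φ (h * g * h') = φ g := by
    intro h h' g hh hh'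
    simp only [hφ]
    rw [hmul, hmul, hh']
    have := hin h (ρ g v) v
    rwa [hh] at this
  have hψ : ∀ g g' : GG, g 1 0 ≠ 0 → g 1 0 = g' 1 0 → φ g = φ g' := by
    intro g g' hg hgg
    have hg' : g' 1 0 ≠ 0 := hgg ▸ hg
    rw [w_decomp g hg, w_decomp g' hg', hbi _ _ _ (hv _) (hv _), hbi _ _ _ (hv _) (hv _)]
    congr 1
    apply GG_ext <;> simp only [mat00, mat01, mat10, mat11, hgg]
  have hdg : ∀ τ, ρ (dg τ) v = v := by
    intro τ
    apply hfix
    have c1 : Tendsto (fun c : ℝ => φ (lo c)) (𝓝[≠] 0) (𝓝 (φ (lo 0))) :=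
      ((hφc.comp continuous_lo).tendsto 0).mono_left nhdsWithin_le_nhds
    have c2 : Tendsto (fun c : ℝ => φ (lo c * dg τ)) (𝓝[≠] 0) (𝓝 (φ (lo 0 * dg τ))) :=
      ((hφc.comp (continuous_lo.mul continuous_const)).tendsto 0).mono_left nhdsWithin_le_nhds
    have c3 : Tendsto (fun c : ℝ => φ (lo (c * Real.exp τ))) (𝓝[≠] 0) (𝓝 (φ (lo (0 * Real.exp τ)))) :=
      ((hφc.comp (continuous_lo.comp (continuous_id.mul continuous_const))).tendsto
        0).mono_left nhdsWithin_le_nhds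
    rw [lo_zero, one_mul] at c2
    rw [zero_mul, lo_zero] at c3
    refine tendsto_nhds_unique (c2.congr' ?_) c3
    filter_upwards [self_mem_nhdsWithin] with c hc
    have hc : c ≠ 0 := hc
    apply hψ
    · simp only [mul10, lo, dg, mat10, mat11, mat00]
      simpa using hc
    · simp only [mul10, lo, dg, mat10, mat11, mat00]; ring
  have hlo : ∀ c, ρ (lo c) v = v := by
    intro c
    apply hfix
    have e : ∀ τ, φ (lo (c * Real.exp (-(2 * τ)))) = φ (lo c) := by
      intro τ
      rw [← hbi (dg τ) (dg (-τ)) (lo c) (hdg _) (hdg _)]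
      congr 1
      have h1 := exp_mul_neg τ
      have h2 : Real.exp (-(2 * τ)) = Real.exp (-τ) * Real.exp (-τ) := by
        rw [← Real.exp_add]; ring_nf
      apply GG_ext <;>
        simp only [mul00, mul01, mul10, mul11, lo, dg, mat00, mat01, mat10, mat11, neg_neg]
      · linear_combination -h1
      · ring
      · rw [h2]; ring
      · linear_combination -h1
    have t1 : Tendsto (fun τ : ℝ => c * Real.exp (-(2 * τ))) atTop (𝓝 (c * 0)) := by
      apply Tendsto.const_mul
      apply Real.tendsto_exp_neg_atTop_nhds_zero.comp
      exact tendsto_id.const_mul_atTop two_pos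
    have t2 := ((hφc.comp continuous_lo).tendsto (c * 0)).comp t1
    have t3 : Tendsto (fun _ : ℝ => φ (lo c)) atTop (𝓝 (φ (lo (c * 0)))) :=
      t2.congr (fun τ => e τ)
    rw [mul_zero, lo_zero] at t3
    exact tendsto_nhds_unique tendsto_const_nhds t3
  have hne : ∀ g : GG, g 1 0 ≠ 0 → ρ g v = v := by
    intro g hg
    apply hfix
    rw [hψ g (lo (g 1 0)) hg rfl]
    simp only [hφ, hlo, h1]
  intro g
  by_cases hg : g 1 0 = 0
  · have hd := det_GG g
    rw [hg] at hd
    have h11 : g 1 1 ≠ 0 := by rintro h; rw [h] at hd; simp at hd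
    have : g = (g * lo 1) * lo (-1) := by
      rw [mul_assoc]
      have : lo 1 * lo (-1) = 1 := by
        apply GG_ext <;> simp only [one00, one01, one10, one11, mul00, mul01, mul10, mul11,
          lo, mat00, mat01, mat10, mat11] <;> norm_num
      rw [this, mul_one]
    rw [this, hmul, hlo]
    apply hne
    simp only [mul10, lo, mat00, mat10, hg]
    simpa using h11
  · exact hne g hg

end Mautner

/-- Shift estimate. -/
lemma shift_bound (F : ℝ → ℝ) (hF : Continuous F) (M : ℝ) (hM : ∀ x, |F x| ≤ M) (N t : ℝ)
    (hN : 0 < N) :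
    |(∫ r in (0:ℝ)..1, F (N * r + t)) - ∫ r in (0:ℝ)..1, F (N * r)| ≤ 2 * M * |t| / N := by
  have hi : ∀ a b, IntervalIntegrable F volume a b := fun a b => hF.intervalIntegrable a b
  have e1 : (∫ r in (0:ℝ)..1, F (N * r + t)) = N⁻¹ * ∫ r in t..(N + t), F r := by
    rw [intervalIntegral.integral_comp_mul_add _ hN.ne']; simp
  have e2 : (∫ r in (0:ℝ)..1, F (N * r)) = N⁻¹ * ∫ r in (0:ℝ)..N, F r := by
    rw [intervalIntegral.integral_comp_mul_left _ hN.ne']; simp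
  have e3 : (∫ r in t..(N + t), F r) - ∫ r in (0:ℝ)..N, F r
      = (∫ r in N..(N + t), F r) - ∫ r in (0:ℝ)..t, F r := by
    have h1 := intervalIntegral.integral_add_adjacent_intervals (hi 0 t) (hi t (N + t))
    have h2 := intervalIntegral.integral_add_adjacent_intervals (hi 0 N) (hi N (N + t))
    linarith
  have b1 : |∫ r in N..(N + t), F r| ≤ M * |t| := by
    have := intervalIntegral.norm_integral_le_of_norm_le_const (a := N) (b := N + t) (f := F)
      (C := M) (fun x _ => hM x)
    simpa using this
  have b2 : |∫ r in (0:ℝ)..t, F r| ≤ M * |t| := by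
    have := intervalIntegral.norm_integral_le_of_norm_le_const (a := 0) (b := t) (f := F)
      (C := M) (fun x _ => hM x)
    simpa using this
  rw [e1, e2, ← mul_sub, e3, abs_mul, abs_of_pos (inv_pos.2 hN), div_eq_inv_mul]
  apply mul_le_mul_of_nonneg_left _ (inv_pos.2 hN).le
  calc _ ≤ |∫ r in N..(N + t), F r| + |∫ r in (0:ℝ)..t, F r| := abs_sub _ _
    _ ≤ _ := by linarith

/-- time average over `[0,N]` -/
noncomputable def Av (f : XX → ℝ) (N : ℝ) (x : XX) : ℝ :=
  ∫ r in (0:ℝ)..1, f (horocycle (N * r) • x)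

/-- renormalised average -/
noncomputable def Ev (f : XX → ℝ) (τ : ℝ) (x : XX) : ℝ :=
  ∫ r in (0:ℝ)..1, f (dg τ • horocycle r • x)

lemma Ev_eq (f : XX → ℝ) (τ : ℝ) (x : XX) : Ev f τ x = Av f (Real.exp (2 * τ)) (dg τ • x) := by
  unfold Ev Av
  congr 1
  ext r
  rw [smul_smul, smul_smul, dg_horo]

lemma continuous_Av (f : XX → ℝ) (hf : Continuous f) (N : ℝ) : Continuous (Av f N) := by
  unfold Av
  apply intervalIntegral.continuous_parametric_intervalIntegral_of_continuous'
  have := continuous_horocycle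
  show Continuous fun p : XX × ℝ => f (horocycle (N * p.2) • p.1)
  exact hf.comp ((continuous_horocycle.comp (continuous_const.mul continuous_snd)).smul
    continuous_fst)

lemma continuous_Ev (f : XX → ℝ) (hf : Continuous f) (τ : ℝ) : Continuous (Ev f τ) := by
  have : Ev f τ = fun x => Av f (Real.exp (2 * τ)) (dg τ • x) := funext (Ev_eq f τ)
  rw [this]
  exact (continuous_Av f hf _).comp (continuous_const_smul _)

lemma Av_bound (f : XX → ℝ) (M : ℝ) (hM : ∀ x, |f x| ≤ M) (N : ℝ) (x : XX) : |Av f N x| ≤ M := by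
  have := intervalIntegral.norm_integral_le_of_norm_le_const (a := 0) (b := 1)
    (f := fun r => f (horocycle (N * r) • x)) (C := M) (fun r _ => hM _)
  simpa [Av] using this

lemma Ev_bound (f : XX → ℝ) (M : ℝ) (hM : ∀ x, |f x| ≤ M) (N : ℝ) (x : XX) : |Ev f N x| ≤ M := by
  rw [Ev_eq]; exact Av_bound f M hM _ _

lemma Av_shift (f : XX → ℝ) (hf : Continuous f) (M : ℝ) (hM : ∀ x, |f x| ≤ M) (N t : ℝ)
    (hN : 0 < N) (x : XX) : |Av f N (horocycle t • x) - Av f N x| ≤ 2 * M * |t| / N := by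
  have := shift_bound (fun s => f (horocycle s • x))
    (hf.comp (continuous_horocycle.smul continuous_const)) M (fun s => hM _) N t hN
  simpa only [Av, smul_smul, ← horo_add] using this

lemma Av_nat (f : XX → ℝ) (hf : Continuous f) (n : ℕ) (hn : 0 < n) (x : XX) :
    Av f n x = (n : ℝ)⁻¹ * ∑ k ∈ Finset.range n, Av f 1 (horocycle k • x) := by
  have hn' : (0:ℝ) < n := by exact_mod_cast hn
  have hF : Continuous (fun s => f (horocycle s • x)) :=
    hf.comp (continuous_horocycle.smul continuous_const)
  have e1 : Av f n x = (n:ℝ)⁻¹ * ∫ r in ((0:ℕ):ℝ)..(n:ℝ), f (horocycle r • x) := by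
    unfold Av
    rw [intervalIntegral.integral_comp_mul_left (fun s => f (horocycle s • x)) hn'.ne']; simp
  rw [e1, ← intervalIntegral.sum_integral_adjacent_intervals (a := fun k : ℕ => (k:ℝ))
    (fun k _ => hF.intervalIntegrable _ _)]
  congr 1
  apply Finset.sum_congr rfl
  intro k _
  unfold Av
  have : ∀ r : ℝ, f (horocycle (1 * r) • horocycle k • x) = f (horocycle (r + k) • x) := by
    intro r; rw [smul_smul, ← horo_add, one_mul]
  simp only [this]
  rw [intervalIntegral.integral_comp_add_right (fun s => f (horocycle s • x))]
  push_cast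
  rw [zero_add, add_comm]

set_option linter.unusedSectionVars false
section L2
variable [BorelSpace XX] (ν : Measure XX) [IsProbabilityMeasure ν] [SMulInvariantMeasure GG XX ν]

open scoped DomMulAct

instance instFact2 : Fact ((2 : ENNReal) ≠ ⊤) := ⟨by simp⟩

lemma memLp_bc (f : XX → ℝ) (hf : Continuous f) (M : ℝ) (hM : ∀ x, |f x| ≤ M) :
    MemLp f 2 ν :=
  MemLp.of_bound hf.aestronglyMeasurable M (Eventually.of_forall hM)

/-- Koopman -/
noncomputable def koop (g : GG) : Lp ℝ 2 ν →ₗᵢ[ℝ] Lp ℝ 2 ν where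
  toFun v := DomMulAct.mk g • v
  map_add' := smul_add _
  map_smul' _ _ := smul_comm _ _ _
  norm_map' v := DomMulAct.norm_smul_Lp _ v

lemma koop_toLp (g : GG) (f : XX → ℝ) (hf : MemLp f 2 ν) (hf' : MemLp (fun x => f (g • x)) 2 ν) :
    koop ν g (hf.toLp f) = hf'.toLp _ := by
  show DomMulAct.mk g • hf.toLp f = _
  rw [DomMulAct.mk_smul_toLp]

lemma norm_toLp_le (f : XX → ℝ) (hf : MemLp f 2 ν) (C : ℝ) (hC : 0 ≤ C) (h : ∀ x, |f x| ≤ C) :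
    ‖hf.toLp f‖ ≤ C := by
  have := Lp.norm_le_of_ae_bound (f := hf.toLp f) (C := C) hC (by
    filter_upwards [hf.coeFn_toLp] with x hx
    rw [hx]; exact h x)
  have h1 : measureUnivNNReal ν = 1 := by simp [measureUnivNNReal]
  rw [h1] at this
  simpa using this

lemma koop_inv_of_horo (v : Lp ℝ 2 ν) (hv : ∀ t, koop ν (horocycle t) v = v) (g : GG) :
    koop ν g v = v := by
  have hcs : ContinuousSMul GGᵈᵐᵃ (Lp ℝ 2 ν) :=
    MeasureTheory.Lp.instContinuousSMulDomMulAct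
  have := mautner (fun g v => koop ν g⁻¹ v) ?_ ?_ ?_ ?_ v ?_ g⁻¹
  · simpa using this
  · intro g h v
    show DomMulAct.mk (g * h)⁻¹ • v = DomMulAct.mk g⁻¹ • DomMulAct.mk h⁻¹ • v
    rw [smul_smul, _root_.mul_inv_rev, DomMulAct.mk_mul]
  · intro v
    show DomMulAct.mk (1 : GG)⁻¹ • v = v
    rw [inv_one, DomMulAct.mk_one, one_smul]
  · intro g v w
    exact (koop ν g⁻¹).inner_map_map v w
  · intro v
    show Continuous fun g : GG => DomMulAct.mk g⁻¹ • v
    exact (DomMulAct.continuous_mk.comp continuous_inv).smul continuous_const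
  · intro t
    have h0 : koop ν (horocycle t)⁻¹ (koop ν (horocycle t) v) = v := by
      show DomMulAct.mk (horocycle t)⁻¹ • DomMulAct.mk (horocycle t) • v = v
      rw [smul_smul, ← DomMulAct.mk_mul, mul_inv_cancel, DomMulAct.mk_one, one_smul]
    rw [hv t] at h0
    exact h0

lemma tendsto_Av (f : XX → ℝ) (hf : Continuous f) (M : ℝ) (hM : ∀ x, |f x| ≤ M) :
    ∃ v : Lp ℝ 2 ν, (∀ g, koop ν g v = v) ∧ Tendsto (fun n : ℕ =>
      (memLp_bc ν (Av f n) (continuous_Av f hf n) M (Av_bound f M hM n)).toLp (Av f n))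
      atTop (𝓝 v) := by
  set A : ℕ → Lp ℝ 2 ν := fun n =>
      (memLp_bc ν (Av f n) (continuous_Av f hf n) M (Av_bound f M hM n)).toLp (Av f n) with hA
  set U := (koop ν (horocycle 1)).toContinuousLinearMap with hU
  have hm1 : ∀ g : GG, MemLp (fun x => Av f 1 (g • x)) 2 ν := fun g =>
    memLp_bc ν _ ((continuous_Av f hf 1).comp (continuous_const_smul g)) M
      (fun x => Av_bound f M hM 1 _)
  set h := (memLp_bc ν (Av f 1) (continuous_Av f hf 1) M (Av_bound f M hM 1)).toLp (Av f 1) with hh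
  have hit : ∀ k : ℕ, U^[k] h = (hm1 (horocycle k)).toLp _ := by
    intro k
    induction k with
    | zero =>
      simp only [Function.iterate_zero, id, hh]
      congr 1
      ext x
      simp [horo_zero]
    | succ k ih =>
      rw [Function.iterate_succ_apply', ih]
      show koop ν (horocycle 1) _ = _
      rw [koop_toLp ν _ _ _ (by
        have := hm1 (horocycle k * horocycle 1)
        simpa only [smul_smul] using this)]
      congr 1
      ext x
      rw [smul_smul, ← horo_add]
      push_cast
      rfl
  have hbirk : ∀ n : ℕ, 0 < n → birkhoffAverage ℝ U _root_.id n h = A n := by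
    intro n hn
    rw [birkhoffAverage, birkhoffSum]
    simp only [id, hit]
    apply Lp.ext
    have h1 : ∀ᵐ x ∂ν, ∀ k ∈ Finset.range n, ((hm1 (horocycle k)).toLp _ : Lp ℝ 2 ν) x
        = Av f 1 (horocycle k • x) := by
      rw [Filter.eventually_all_finset]
      intro k _
      exact (hm1 (horocycle k)).coeFn_toLp
    filter_upwards [h1, Lp.coeFn_smul (n : ℝ)⁻¹
      (∑ k ∈ Finset.range n, ((hm1 (horocycle k)).toLp _ : Lp ℝ 2 ν)),
      Lp.coeFn_finsetSum (Finset.range n) (fun k : ℕ => ((hm1 (horocycle k)).toLp _ : Lp ℝ 2 ν)),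
      (memLp_bc ν (Av f n) (continuous_Av f hf n) M (Av_bound f M hM n)).coeFn_toLp]
      with x h1 h2 h3 h4
    rw [h2, h4, Av_nat f hf n hn, Pi.smul_apply, h3, smul_eq_mul, Finset.sum_apply]
    congr 1
    exact Finset.sum_congr rfl h1
  have hU1 : ‖U‖ ≤ 1 := LinearIsometry.norm_toContinuousLinearMap_le _
  have hlim := ContinuousLinearMap.tendsto_birkhoffAverage_orthogonalProjection U hU1 h
  set v : Lp ℝ 2 ν := ((U.eqLocus (1 : Lp ℝ 2 ν →L[ℝ] Lp ℝ 2 ν)).orthogonalProjectionOnto h :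
    Lp ℝ 2 ν) with hv
  have hAlim : Tendsto A atTop (𝓝 v) := by
    refine hlim.congr' ?_
    filter_upwards [eventually_gt_atTop 0] with n hn using hbirk n hn
  refine ⟨v, ?_, hAlim⟩
  intro g
  apply koop_inv_of_horo
  intro t
  have l1 : Tendsto (fun n => koop ν (horocycle t) (A n) - A n) atTop
      (𝓝 (koop ν (horocycle t) v - v)) :=
    (((koop ν (horocycle t)).continuous.tendsto v).comp hAlim).sub hAlim
  have l2 : Tendsto (fun n => koop ν (horocycle t) (A n) - A n) atTop (𝓝 0) := by
    have hz : Tendsto (fun n : ℕ => 2 * M * |t| / (n : ℝ)) atTop (𝓝 0) :=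
      tendsto_const_div_atTop_nhds_zero_nat _
    refine squeeze_zero_norm' ?_ hz
    filter_upwards [eventually_gt_atTop 0] with n hn
    have hn' : (0:ℝ) < n := by exact_mod_cast hn
    have hmm : MemLp (fun x => Av f n (horocycle t • x)) 2 ν :=
      memLp_bc ν _ ((continuous_Av f hf n).comp (continuous_const_smul _)) M
        (fun x => Av_bound f M hM n _)
    rw [hA]
    simp only
    rw [koop_toLp ν _ _ _ hmm, ← MemLp.toLp_sub]
    have hM0 : 0 ≤ M := (abs_nonneg _).trans (hM (1 : GG))
    apply norm_toLp_le
    · positivity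
    · intro x
      exact Av_shift f hf M hM n t hn' x
  have := tendsto_nhds_unique l1 l2
  exact sub_eq_zero.1 this

end L2

/-- renormalisation time -/
noncomputable def tn (n : ℕ) : ℝ := Real.log n / 2

lemma exp_tn (n : ℕ) (hn : 0 < n) : Real.exp (2 * tn n) = n := by
  have hn' : (0:ℝ) < n := by exact_mod_cast hn
  rw [tn, mul_div_cancel₀ _ (two_ne_zero), Real.exp_log hn']

lemma Ev_tn (f : XX → ℝ) (n : ℕ) (hn : 0 < n) (x : XX) :
    Ev f (tn n) x = Av f n (dg (tn n) • x) := by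
  rw [Ev_eq, exp_tn n hn]

lemma Ev_inMeasure [BorelSpace XX] (ν : Measure XX) [IsProbabilityMeasure ν]
    [SMulInvariantMeasure GG XX ν] (f : XX → ℝ) (hf : Continuous f) (M : ℝ) (hM : ∀ x, |f x| ≤ M) (g : GG) :
    TendstoInMeasure ν (fun (n : ℕ) x => Ev f (tn n) (g • x) - Ev f (tn n) x) atTop
      (fun _ => (0 : ℝ)) := by
  obtain ⟨v, hv, hlim⟩ := tendsto_Av ν f hf M hM
  set A : ℕ → Lp ℝ 2 ν := fun n =>
      (memLp_bc ν (Av f n) (continuous_Av f hf n) M (Av_bound f M hM n)).toLp (Av f n) with hA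
  have l1 : Tendsto (fun n => koop ν g (koop ν (dg (tn n)) (A n)) - koop ν (dg (tn n)) (A n)) atTop
      (𝓝 0) := by
    have hz : Tendsto (fun n => ‖A n - v‖ + ‖A n - v‖) atTop (𝓝 (0 + 0)) :=
      (tendsto_iff_norm_sub_tendsto_zero.1 hlim).add (tendsto_iff_norm_sub_tendsto_zero.1 hlim)
    rw [add_zero] at hz
    refine squeeze_zero_norm (fun n => ?_) hz
    have e : koop ν g (koop ν (dg (tn n)) (A n)) - koop ν (dg (tn n)) (A n)
      = koop ν g (koop ν (dg (tn n)) (A n - v)) - koop ν (dg (tn n)) (A n - v) := by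
      rw [map_sub, map_sub, hv, hv]; abel
    rw [e]
    refine (norm_sub_le _ _).trans ?_
    rw [LinearIsometry.norm_map, LinearIsometry.norm_map]
  have hm : ∀ n (g : GG), MemLp (fun x => Av f n (g • x)) 2 ν := fun n g =>
    memLp_bc ν _ ((continuous_Av f hf n).comp (continuous_const_smul g)) M
      (fun x => Av_bound f M hM n _)
  have l2 := tendstoInMeasure_of_tendsto_Lp l1
  refine l2.congr' ?_ ?_
  · filter_upwards [eventually_gt_atTop 0] with n hn
    have hmm : MemLp (fun x => Av f n (dg (tn n) • g • x)) 2 ν := by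
      simpa only [smul_smul] using hm n (dg (tn n) * g)
    rw [hA]
    simp only
    rw [koop_toLp ν _ _ _ (hm n (dg (tn n))), koop_toLp ν _ _ _ hmm, ← MemLp.toLp_sub]
    refine (MemLp.coeFn_toLp _).trans ?_
    filter_upwards with x
    rw [Ev_tn f n hn, Ev_tn f n hn]
    rfl
  · exact Lp.coeFn_zero _ _ _

lemma unif_cont (f : XX → ℝ) (hf : Continuous f) (hfc : HasCompactSupport f) (ε : ℝ) (hε : 0 < ε) :
    ∀ᶠ g in 𝓝 (1 : GG), ∀ x, |f (g • x) - f x| ≤ ε := by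
  have h1 : ∀ᶠ g in 𝓝 (1 : GG), ∀ x ∈ tsupport f, |f (g • x) - f x| < ε := by
    apply IsCompact.eventually_forall_of_forall_eventually hfc
    intro y _
    have hc : Continuous fun z : GG × XX => |f (z.1 • z.2) - f z.2| := by
      apply Continuous.abs
      exact (hf.comp (continuous_fst.smul continuous_snd)).sub (hf.comp continuous_snd)
    have : ∀ᶠ z : GG × XX in 𝓝 (1, y), |f (z.1 • z.2) - f z.2| < ε := by
      apply (hc.tendsto (1, y)).eventually_lt_const
      simpa using hε
    exact this
  have h2 : ∀ᶠ g in 𝓝 (1 : GG), ∀ x ∈ tsupport f, |f (g⁻¹ • x) - f x| < ε := by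
    have : Tendsto (fun g : GG => g⁻¹) (𝓝 1) (𝓝 1) := by
      simpa using (continuous_inv (G := GG)).tendsto 1
    exact this.eventually h1
  filter_upwards [h1, h2] with g h1 h2 x
  by_cases hx : x ∈ tsupport f
  · exact (h1 x hx).le
  · by_cases hgx : g • x ∈ tsupport f
    · have := h2 _ hgx
      rw [inv_smul_smul, abs_sub_comm] at this
      exact this.le
    · rw [image_eq_zero_of_notMem_tsupport hx, image_eq_zero_of_notMem_tsupport hgx]
      simpa using hε.le

/-- entrywise closeness to the identity -/
def near1 (η : ℝ) (g : GG) : Prop :=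
  |g 0 0 - 1| < η ∧ |g 0 1| < η ∧ |g 1 0| < η ∧ |g 1 1 - 1| < η

lemma eventually_near1 (η : ℝ) (hη : 0 < η) : ∀ᶠ g in 𝓝 (1 : GG), near1 η g := by
  have h00 := ((((continuous_entry 0 0).sub continuous_const).abs.tendsto (1 : GG))
    : Tendsto (fun g : GG => |g 0 0 - 1|) _ _).eventually_lt_const (u := η) (by simpa using hη)
  have h01 := (((continuous_entry 0 1).abs.tendsto (1 : GG))
    : Tendsto (fun g : GG => |g 0 1|) _ _).eventually_lt_const (u := η) (by simpa using hη)
  have h10 := (((continuous_entry 1 0).abs.tendsto (1 : GG))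
    : Tendsto (fun g : GG => |g 1 0|) _ _).eventually_lt_const (u := η) (by simpa using hη)
  have h11 := ((((continuous_entry 1 1).sub continuous_const).abs.tendsto (1 : GG))
    : Tendsto (fun g : GG => |g 1 1 - 1|) _ _).eventually_lt_const (u := η) (by simpa using hη)
  filter_upwards [h00, h01, h10, h11] with g a b c d
  exact ⟨a, b, c, d⟩

lemma exists_near1 {P : GG → Prop} (hP : ∀ᶠ g in 𝓝 (1 : GG), P g) :
    ∃ η > 0, ∀ g, near1 η g → P g := by
  have h : {g | P g} ∈ 𝓝 (1 : GG) := hP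
  rw [val_isClosedEmbedding.isInducing.nhds_eq_comap, mem_comap] at h
  obtain ⟨t, ht, hts⟩ := h
  obtain ⟨η, hη, hb⟩ := (Metric.mem_nhds_iff (α := Fin 2 → Fin 2 → ℝ)).1 ht
  refine ⟨η, hη, fun g hg => ?_⟩
  apply hts
  apply hb
  refine (dist_pi_lt_iff hη).2 fun i => (dist_pi_lt_iff hη).2 fun j => ?_
  obtain ⟨a, b, c, d⟩ := hg
  show |g i j - (1 : GG) i j| < η
  fin_cases i <;> fin_cases j
  · simpa using a
  · simpa using b
  · simpa using c
  · simpa using d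

lemma reparam (F : ℝ → ℝ) (hF : Continuous F) (M : ℝ) (hM : ∀ x, |F x| ≤ M) (α β γ δ η : ℝ)
    (hdet : α * δ - β * γ = 1) (hα : |α - 1| < η) (hβ : |β| < η) (hγ : |γ| < η) (hδ : |δ - 1| < η)
    (hη : η ≤ 1/8) :
    |(∫ r in (0:ℝ)..1, F ((β + r * δ) / (α + r * γ))) - ∫ r in (0:ℝ)..1, F r| ≤ 30 * M * η := by
  have hM0 : 0 ≤ M := (abs_nonneg _).trans (hM 0)
  rw [abs_lt] at hα hβ hγ hδ
  have hη0 : 0 < η := by linarith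
  have hp : ∀ r ∈ Set.Icc (0:ℝ) 1, |α + r * γ - 1| ≤ 2 * η := by
    intro r hr
    rw [abs_le]
    constructor <;> nlinarith [hr.1, hr.2]
  have hp' : ∀ r ∈ Set.Icc (0:ℝ) 1, 3/4 ≤ α + r * γ := by
    intro r hr
    have := (abs_le.1 (hp r hr)).1
    linarith
  have hI : Set.uIcc (0:ℝ) 1 = Set.Icc 0 1 := Set.uIcc_of_le zero_le_one
  have hrc : ContinuousOn (fun r : ℝ => (β + r * δ) / (α + r * γ)) (Set.uIcc 0 1) := by
    rw [hI]
    apply ContinuousOn.div (by fun_prop) (by fun_prop)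
    intro r hr
    have := hp' r hr
    linarith
  have hdc : ContinuousOn (fun r : ℝ => 1 / (α + r * γ) ^ 2) (Set.uIcc 0 1) := by
    rw [hI]
    apply ContinuousOn.div (by fun_prop) (by fun_prop)
    intro r hr
    have := hp' r hr
    positivity
  have hder : ∀ r ∈ Set.uIcc (0:ℝ) 1,
      HasDerivAt (fun r : ℝ => (β + r * δ) / (α + r * γ)) (1 / (α + r * γ) ^ 2) r := by
    rw [hI]
    intro r hr
    have h0 : α + r * γ ≠ 0 := by have := hp' r hr; linarith
    have d1 : HasDerivAt (fun r : ℝ => β + r * δ) δ r := by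
      simpa using ((hasDerivAt_id r).mul_const δ).const_add β
    have d2 : HasDerivAt (fun r : ℝ => α + r * γ) γ r := by
      simpa using ((hasDerivAt_id r).mul_const γ).const_add α
    have d3 := d1.div d2 h0
    have e : (1 : ℝ) / (α + r * γ) ^ 2 =
        (δ * (α + r * γ) - (β + r * δ) * γ) / (α + r * γ) ^ 2 := by
      rw [show δ * (α + r * γ) - (β + r * δ) * γ = 1 by linear_combination hdet]
    rw [e]
    exact d3
  have hsub := intervalIntegral.integral_comp_mul_deriv hder hdc hF
  simp only [Function.comp] at hsub
  have hFr : ContinuousOn (fun r : ℝ => F ((β + r * δ) / (α + r * γ))) (Set.uIcc 0 1) :=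
    hF.comp_continuousOn hrc
  have hFd : ContinuousOn (fun r : ℝ => F ((β + r * δ) / (α + r * γ)) * (1 / (α + r * γ) ^ 2))
    (Set.uIcc 0 1) := hFr.mul hdc
  have s1 : |(∫ r in (0:ℝ)..1, F ((β + r * δ) / (α + r * γ))) -
      ∫ r in (0:ℝ)..1, F ((β + r * δ) / (α + r * γ)) * (1 / (α + r * γ) ^ 2)| ≤ 20 * M * η := by
    rw [← intervalIntegral.integral_sub hFr.intervalIntegrable
      hFd.intervalIntegrable]
    have := intervalIntegral.norm_integral_le_of_norm_le_const (a := 0) (b := 1)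
      (f := fun r => F ((β + r * δ) / (α + r * γ)) -
        F ((β + r * δ) / (α + r * γ)) * (1 / (α + r * γ) ^ 2)) (C := 20 * M * η) ?_
    · simpa using this
    · intro r hr
      rw [Set.uIoc_of_le zero_le_one] at hr
      have hr' : r ∈ Set.Icc (0:ℝ) 1 := ⟨hr.1.le, hr.2⟩
      have hp1 := abs_le.1 (hp r hr')
      have hp2 := hp' r hr'
      set p := α + r * γ with hpdef
      have hb : |1 - 1 / p ^ 2| ≤ 20 * η := by
        have hpp : 0 < p ^ 2 := by positivity
        have : 1 - 1 / p ^ 2 = (p ^ 2 - 1) / p ^ 2 := by field_simp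
        rw [this, abs_div, abs_of_pos hpp, div_le_iff₀ hpp, abs_le]
        have h4 : 9/16 ≤ p ^ 2 := by nlinarith
        have h5 : 20 * η * (9/16) ≤ 20 * η * p ^ 2 := by gcongr
        have h8 : p ≤ 5/4 := by linarith
        have h6 : p ^ 2 - 1 ≤ 5 * η := by nlinarith
        have h7 : -(5 * η) ≤ p ^ 2 - 1 := by nlinarith
        constructor <;> linarith
      have e : F ((β + r * δ) / p) - F ((β + r * δ) / p) * (1 / p ^ 2)
        = F ((β + r * δ) / p) * (1 - 1 / p ^ 2) := by ring
      rw [e, Real.norm_eq_abs, abs_mul]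
      calc _ ≤ M * (20 * η) := mul_le_mul (hM _) hb (abs_nonneg _) hM0
        _ = _ := by ring
  have hi : ∀ a b, IntervalIntegrable F volume a b := fun a b => hF.intervalIntegrable a b
  set a0 := (β + 0 * δ) / (α + 0 * γ) with ha0
  set a1 := (β + 1 * δ) / (α + 1 * γ) with ha1
  have q0 := hp' 0 (by simp)
  have q1 := hp' 1 (by simp)
  have ba0 : |a0| ≤ 2 * η := by
    rw [ha0, abs_div, abs_of_pos (by linarith : 0 < α + 0 * γ), div_le_iff₀ (by linarith), abs_le]
    constructor <;> nlinarith
  have ba1 : |a1 - 1| ≤ 8 * η := by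
    have : a1 - 1 = (β + δ - α - γ) / (α + 1 * γ) := by
      rw [ha1]
      have : α + 1 * γ ≠ 0 := by linarith
      rw [div_sub_one this]
      congr 1
      ring
    rw [this, abs_div, abs_of_pos (by linarith : 0 < α + 1 * γ), div_le_iff₀ (by linarith), abs_le]
    constructor <;> nlinarith
  have s2 : |(∫ r in a0..a1, F r) - ∫ r in (0:ℝ)..1, F r| ≤ 10 * M * η := by
    have h1 := intervalIntegral.integral_add_adjacent_intervals (hi 0 a0) (hi a0 a1)
    have h2 := intervalIntegral.integral_add_adjacent_intervals (hi 0 1) (hi 1 a1)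
    have e : (∫ r in a0..a1, F r) - ∫ r in (0:ℝ)..1, F r
      = (∫ r in (1:ℝ)..a1, F r) - ∫ r in (0:ℝ)..a0, F r := by linarith
    have b1 : |∫ r in (1:ℝ)..a1, F r| ≤ M * |a1 - 1| := by
      simpa only [Real.norm_eq_abs] using
        intervalIntegral.norm_integral_le_of_norm_le_const (f := F) (C := M) (fun x _ => hM x)
    have b2 : |∫ r in (0:ℝ)..a0, F r| ≤ M * |a0 - 0| := by
      simpa only [Real.norm_eq_abs] using
        intervalIntegral.norm_integral_le_of_norm_le_const (f := F) (C := M) (fun x _ => hM x)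
    rw [sub_zero] at b2
    rw [e]
    refine (abs_sub _ _).trans ?_
    nlinarith
  rw [hsub] at s1
  calc _ ≤ _ := abs_sub_le _ (∫ r in a0..a1, F r) _
    _ ≤ _ := by linarith

lemma equicont (f : XX → ℝ) (hf : Continuous f) (hfc : HasCompactSupport f) (ε : ℝ) (hε : 0 < ε) :
    ∀ᶠ q in 𝓝 (1 : GG), ∀ τ : ℝ, 0 ≤ τ → ∀ x, |Ev f τ (q • x) - Ev f τ x| ≤ ε := by
  obtain ⟨M, hM⟩ := hfc.exists_bound_of_continuous hf
  have hM : ∀ x, |f x| ≤ M := hM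
  have hM0 : 0 ≤ M := (abs_nonneg _).trans (hM (1 : GG))
  obtain ⟨η, hη, hV⟩ := exists_near1 (unif_cont f hf hfc (ε / 2) (by linarith))
  have hM1 : 0 < 60 * M + 1 := by linarith
  set ζ := min (1/8) (min (η / 4) (ε / (60 * M + 1))) with hζ
  have hζ0 : 0 < ζ := by rw [hζ]; positivity
  have z1 : ζ ≤ 1/8 := min_le_left _ _
  have z2 : ζ ≤ η / 4 := (min_le_right _ _).trans (min_le_left _ _)
  have z3 : ζ ≤ ε / (60 * M + 1) := (min_le_right _ _).trans (min_le_right _ _)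
  have z4 : 30 * M * ζ ≤ ε / 2 := by
    rw [le_div_iff₀ hM1] at z3
    nlinarith
  filter_upwards [eventually_near1 ζ hζ0] with q hq τ hτ x
  obtain ⟨hα, hβ, hγ, hδ⟩ := hq
  have hdet := det_GG q
  set α := q 0 0 with hα'
  set β := q 0 1 with hβ'
  set γ := q 1 0 with hγ'
  set δ := q 1 1 with hδ'
  have hFc : Continuous fun r => f (dg τ • horocycle r • x) := by
    apply hf.comp
    exact (continuous_const_smul (dg τ)).comp (continuous_horocycle.smul continuous_const)
  have hr := reparam (fun r => f (dg τ • horocycle r • x)) hFc M (fun _ => hM _) α β γ δ ζ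
    hdet hα hβ hγ hδ z1
  rw [abs_lt] at hα hβ hγ hδ
  have key : |Ev f τ (q • x) -
      ∫ r in (0:ℝ)..1, f (dg τ • horocycle ((β + r * δ) / (α + r * γ)) • x)| ≤ ε / 2 := by
    have hp' : ∀ r ∈ Set.Icc (0:ℝ) 1, 3/4 ≤ α + r * γ := by
      intro r hr
      nlinarith [hr.1, hr.2]
    unfold Ev
    rw [← intervalIntegral.integral_sub]
    · have := intervalIntegral.norm_integral_le_of_norm_le_const (a := 0) (b := 1)
        (f := fun r => f (dg τ • horocycle r • q • x) -
          f (dg τ • horocycle ((β + r * δ) / (α + r * γ)) • x)) (C := ε / 2) ?_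
      · simpa using this
      · intro r hr
        rw [Set.uIoc_of_le zero_le_one] at hr
        have hr' : r ∈ Set.Icc (0:ℝ) 1 := ⟨hr.1.le, hr.2⟩
        have hp2 := hp' r hr'
        have hp1 : |α + r * γ - 1| ≤ 2 * ζ := by
          rw [abs_le]
          constructor <;> nlinarith [hr'.1, hr'.2]
        rw [abs_le] at hp1
        have hp0 : α + r * γ ≠ 0 := by linarith
        have hκ : Real.exp (-(2 * τ)) ≤ 1 := by
          rw [Real.exp_le_one_iff]; linarith
        have hκ0 := Real.exp_pos (-(2 * τ))
        set P := mat (α + r * γ) 0 (Real.exp (-(2 * τ)) * γ) (α + r * γ)⁻¹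
          (by rw [mul_inv_cancel₀ hp0]; ring) with hP
        have hid : dg τ * horocycle r * q =
            P * (dg τ * horocycle ((β + r * δ) / (α + r * γ))) := by
          have h2 : Real.exp (-(2 * τ)) = Real.exp (-τ) * Real.exp (-τ) := by
            rw [← Real.exp_add]; ring_nf
          have h1 := exp_mul_neg τ
          apply GG_ext <;>
            simp only [mul00, mul01, mul10, mul11, hP, dg, horo_eq, mat00, mat01, mat10, mat11,
              ← hα', ← hβ', ← hγ', ← hδ', h2]
          · ring
          · field_simp; ring
          · linear_combination -(Real.exp (-τ) * γ) * h1
          · have hpi := mul_inv_cancel₀ hp0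
            rw [div_eq_mul_inv]
            linear_combination -(Real.exp (-τ) * γ * (β + r * δ) * (α + r * γ)⁻¹) * h1
              + Real.exp (-τ) * (α + r * γ)⁻¹ * hdet - Real.exp (-τ) * δ * hpi
        have hnear : near1 η P := by
          refine ⟨?_, ?_, ?_, ?_⟩
          · rw [hP, mat00, abs_lt]; constructor <;> linarith
          · rw [hP, mat01, abs_zero]; exact hη
          · rw [hP, mat10, abs_lt]
            constructor <;> nlinarith
          · rw [hP, mat11]
            have : (α + r * γ)⁻¹ - 1 = (1 - (α + r * γ)) / (α + r * γ) := by field_simp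
            rw [this, abs_div, abs_of_pos (by linarith : 0 < α + r * γ),
              div_lt_iff₀ (by linarith), abs_lt]
            constructor <;> nlinarith
        have := hV P hnear (dg τ • horocycle ((β + r * δ) / (α + r * γ)) • x)
        rw [smul_smul (dg τ), smul_smul P, ← hid] at this
        rw [smul_smul (dg τ), smul_smul (dg τ * horocycle r), smul_smul (dg τ)]
        exact this
    · apply Continuous.intervalIntegrable
      apply hf.comp
      exact (continuous_const_smul (dg τ)).comp (continuous_horocycle.smul continuous_const)
    · apply ContinuousOn.intervalIntegrable
      apply hFc.comp_continuousOn
      rw [Set.uIcc_of_le zero_le_one]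
      apply ContinuousOn.div (by fun_prop) (by fun_prop)
      intro r hr
      have := hp' r hr
      linarith
  calc _ ≤ _ := abs_sub_le _ _ _
    _ ≤ ε / 2 + ε / 2 := add_le_add key (hr.trans z4)
    _ = ε := by ring

lemma tn_nonneg (n : ℕ) : 0 ≤ tn n := by
  unfold tn
  have := Real.log_natCast_nonneg n
  linarith

lemma Ev_pointwise [BorelSpace XX] (ν : Measure XX) [IsProbabilityMeasure ν]
    [SMulInvariantMeasure GG XX ν] (f : XX → ℝ) (hf : Continuous f) (hfc : HasCompactSupport f)
    (g : GG) (x0 : XX) :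
    Tendsto (fun n : ℕ => Ev f (tn n) (g • x0) - Ev f (tn n) x0) atTop (𝓝 0) := by
  obtain ⟨M, hM⟩ := hfc.exists_bound_of_continuous hf
  have hM : ∀ x, |f x| ≤ M := hM
  rw [Metric.tendsto_nhds]
  intro ε' hε'
  set ε := ε' / 4 with hεd
  have hε : 0 < ε := by rw [hεd]; linarith
  have hQ := equicont f hf hfc ε hε
  have hconj : Tendsto (fun q : GG => g * q * g⁻¹) (𝓝 1) (𝓝 1) := by
    have : Continuous fun q : GG => g * q * g⁻¹ := by fun_prop
    simpa using this.tendsto 1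
  have hW := hQ.and (hconj.eventually hQ)
  set W : Set GG := {q | (∀ τ : ℝ, 0 ≤ τ → ∀ x, |Ev f τ (q • x) - Ev f τ x| ≤ ε) ∧
    ∀ τ : ℝ, 0 ≤ τ → ∀ x, |Ev f τ ((g * q * g⁻¹) • x) - Ev f τ x| ≤ ε} with hWd
  have hWn : W ∈ 𝓝 (1 : GG) := hW
  have hopen : IsOpenMap (fun q : GG => q • x0) := isOpenMap_smul_of_sigmaCompact x0
  set O := (fun q : GG => q • x0) '' interior W with hO
  have hOo : IsOpen O := hopen _ isOpen_interior
  have hOn : O.Nonempty := ⟨_, ⟨1, mem_interior_iff_mem_nhds.2 hWn, rfl⟩⟩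
  have hpos : 0 < ν O := by
    exact measure_isOpen_pos_of_smulInvariant_of_ne_zero GG (IsProbabilityMeasure.ne_zero ν) hOo hOn
  have hm := tendstoInMeasure_iff_norm.1 (Ev_inMeasure ν f hf M hM g) ε hε
  have hev := hm.eventually_lt_const hpos
  filter_upwards [hev] with n hn
  by_contra hcon
  rw [dist_zero_right, Real.norm_eq_abs, not_lt] at hcon
  refine absurd (measure_mono ?_) (not_le.2 hn)
  rintro _ ⟨q, hq, rfl⟩
  obtain ⟨h1, h2⟩ := interior_subset hq
  have h1 := h1 (tn n) (tn_nonneg n) x0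
  have h2 := h2 (tn n) (tn_nonneg n) (g • x0)
  rw [smul_smul, inv_mul_cancel_right, ← smul_smul] at h2
  simp only [Set.mem_ofPred_eq, sub_zero, Real.norm_eq_abs]
  have e1 := abs_sub_abs_le_abs_sub (Ev f (tn n) (g • x0) - Ev f (tn n) x0)
    (Ev f (tn n) (g • q • x0) - Ev f (tn n) (q • x0))
  have e2 : |(Ev f (tn n) (g • x0) - Ev f (tn n) x0) -
    (Ev f (tn n) (g • q • x0) - Ev f (tn n) (q • x0))| ≤ 2 * ε := by
    rw [abs_le] at h1 h2 ⊢
    constructor <;> linarith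
  linarith

lemma integral_Ev [BorelSpace XX] (ν : Measure XX) [IsProbabilityMeasure ν]
    [SMulInvariantMeasure GG XX ν] (f : XX → ℝ) (hf : Continuous f) (hfc : HasCompactSupport f)
    (τ : ℝ) : ∫ x, Ev f τ x ∂ν = ∫ x, f x ∂ν := by
  obtain ⟨M, hM⟩ := hfc.exists_bound_of_continuous hf
  unfold Ev
  simp_rw [intervalIntegral.integral_of_le (zero_le_one (α := ℝ))]
  rw [integral_integral_swap]
  · have : ∀ r : ℝ, ∫ x, f (dg τ • horocycle r • x) ∂ν = ∫ x, f x ∂ν := by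
      intro r
      simp_rw [smul_smul]
      exact integral_smul_eq_self f
    simp_rw [this]
    simp
  · have hc : Continuous (Function.uncurry fun (x : XX) (r : ℝ) => f (dg τ • horocycle r • x)) := by
      apply hf.comp
      exact (continuous_const_smul (dg τ)).comp
        ((continuous_horocycle.comp continuous_snd).smul continuous_fst)
    refine Integrable.of_bound hc.aestronglyMeasurable M ?_
    exact Eventually.of_forall fun z => hM _

lemma Ev_tendsto [BorelSpace XX] (ν : Measure XX) [IsProbabilityMeasure ν]
    [SMulInvariantMeasure GG XX ν] (f : XX → ℝ) (hf : Continuous f) (hfc : HasCompactSupport f)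
    (x0 : XX) :
    Tendsto (fun n : ℕ => Ev f (tn n) x0) atTop (𝓝 (∫ x, f x ∂ν)) := by
  obtain ⟨M, hM⟩ := hfc.exists_bound_of_continuous hf
  have hM : ∀ x, |f x| ≤ M := hM
  have h := tendsto_integral_of_dominated_convergence (μ := ν) (f := fun _ => (0:ℝ))
    (F := fun (n : ℕ) x => Ev f (tn n) x - Ev f (tn n) x0) (fun _ => 2 * M)
    (fun n => ((continuous_Ev f hf (tn n)).sub continuous_const).aestronglyMeasurable)
    (integrable_const _)
    (fun n => Eventually.of_forall fun x => by
      have h1 := Ev_bound f M hM (tn n) x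
      have h2 := Ev_bound f M hM (tn n) x0
      rw [Real.norm_eq_abs]
      refine (abs_sub _ _).trans ?_
      linarith)
    (Eventually.of_forall fun x => by
      obtain ⟨g, rfl⟩ := MulAction.exists_smul_eq GG x0 x
      exact Ev_pointwise ν f hf hfc g x0)
  have h3 : ∀ n : ℕ, ∫ x, (Ev f (tn n) x - Ev f (tn n) x0) ∂ν = ∫ x, f x ∂ν - Ev f (tn n) x0 := by
    intro n
    rw [integral_sub, integral_Ev ν f hf hfc]
    · simp
    · refine Integrable.of_bound (continuous_Ev f hf (tn n)).aestronglyMeasurable M ?_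
      exact Eventually.of_forall fun z => Ev_bound f M hM (tn n) z
    · exact integrable_const _
  simp_rw [h3] at h
  have h4 := (tendsto_const_nhds (x := ∫ x, f x ∂ν)).sub h
  simpa using h4

lemma Ev_uniform [BorelSpace XX] (ν : Measure XX) [IsProbabilityMeasure ν]
    [SMulInvariantMeasure GG XX ν] (f : XX → ℝ) (hf : Continuous f) (hfc : HasCompactSupport f)
    (K : Set XX) (hK : IsCompact K) (ε : ℝ) (hε : 0 < ε) :
    ∀ᶠ n : ℕ in atTop, ∀ x ∈ K, |Ev f (tn n) x - ∫ x, f x ∂ν| ≤ ε := by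
  suffices hP : ∀ y ∈ K, ∀ᶠ z : ℕ × XX in atTop ×ˢ 𝓝 y, |Ev f (tn z.1) z.2 - ∫ x, f x ∂ν| ≤ ε by
    simp only [← eventually_iSup, ← hK.prod_nhdsSet_eq_biSup] at hP
    exact hP.curry.mono fun _ h => h.self_of_nhdsSet
  intro x0 _
  have hQ := equicont f hf hfc (ε / 2) (by linarith)
  have hopen : IsOpenMap (fun q : GG => q • x0) := isOpenMap_smul_of_sigmaCompact x0
  have hn : (fun q : GG => q • x0) '' {q | ∀ τ : ℝ, 0 ≤ τ → ∀ x, |Ev f τ (q • x) - Ev f τ x| ≤ ε / 2}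
      ∈ 𝓝 x0 := by
    have := hopen.image_mem_nhds (x := (1 : GG)) hQ
    simpa only [one_smul] using this
  have ht := Metric.tendsto_nhds.1 (Ev_tendsto ν f hf hfc x0) (ε / 2) (by linarith)
  filter_upwards [prod_mem_prod ht hn]
  rintro ⟨n, y⟩ ⟨h1, ⟨q, hq, rfl⟩⟩
  have h1 : dist (Ev f (tn n) x0) (∫ x, f x ∂ν) < ε / 2 := h1
  have h2 := hq (tn n) (tn_nonneg n) x0
  rw [Real.dist_eq] at h1
  calc _ ≤ _ := abs_sub_le _ (Ev f (tn n) x0) _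
    _ ≤ ε / 2 + ε / 2 := add_le_add h2 h1.le
    _ = ε := by ring

lemma intmat_mem (m p n q : ℤ) (h : m * q - p * n = 1) :
    mat (m : ℝ) p n q (by exact_mod_cast h) ∈ SLZ2 := by
  refine ⟨⟨!![m, p; n, q], by rw [Matrix.det_fin_two_of]; exact h⟩, ?_⟩
  apply GG_ext <;> rfl

lemma exists_completion (m n : ℤ) (h : IsCoprime m n) : ∃ γ ∈ SLZ2, γ 0 0 = (m : ℝ) ∧
    γ 1 0 = (n : ℝ) := by
  obtain ⟨u, v, huv⟩ := h
  refine ⟨_, intmat_mem m (-v) n u (by linarith), rfl, rfl⟩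

lemma mk_mul_mem (g γ : GG) (h : γ ∈ SLZ2) : ((g * γ : GG) : XX) = (g : XX) :=
  QuotientGroup.mk_mul_of_mem g h

lemma horo_one_mem (k : ℤ) : horocycle k ∈ SLZ2 := by
  have := intmat_mem 1 k 0 1 (by ring)
  convert this using 1
  apply GG_ext <;> simp [horo_eq, mat00, mat01, mat10, mat11]

lemma nonper (g : GG) (ha : ∀ t : ℝ, 0 < t → horocycle t • (g : XX) ≠ (g : XX)) (m n : ℤ)
    (h : IsCoprime m n) : g 1 0 * m + g 1 1 * n ≠ 0 := by
  intro h0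
  obtain ⟨γ, hγ, h1, h2⟩ := exists_completion m n h
  have hy : (g * γ) 1 0 = 0 := by rw [mul10, h1, h2, h0]
  have hd := det_GG (g * γ)
  rw [hy, mul_zero, sub_zero] at hd
  have hx : (g * γ) 0 0 ≠ 0 := left_ne_zero_of_mul_eq_one hd
  refine ha (((g * γ) 0 0) ^ 2) (by positivity) ?_
  have e : horocycle (((g * γ) 0 0) ^ 2) * (g * γ) = (g * γ) * horocycle ((1 : ℤ) : ℝ) := by
    generalize g * γ = k at *
    apply GG_ext <;> simp only [mul00, mul01, mul10, mul11, horo_eq, mat00, mat01, mat10, mat11, hy,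
      Int.cast_one]
    · ring
    · linear_combination k 0 0 * hd
    · ring
    · ring
  calc horocycle (((g * γ) 0 0) ^ 2) • (g : XX)
      = horocycle (((g * γ) 0 0) ^ 2) • ((g * γ : GG) : XX) := by rw [mk_mul_mem g γ hγ]
    _ = ((horocycle (((g * γ) 0 0) ^ 2) * (g * γ) : GG) : XX) := rfl
    _ = (g : XX) := by rw [e, mk_mul_mem _ _ (horo_one_mem 1), mk_mul_mem g γ hγ]

lemma dirichlet (g : GG) (hg : g 1 0 ≠ 0) : ∃ C : ℝ, 1 ≤ C ∧ ∀ R : ℝ, 1 ≤ R →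
    ∃ m n : ℤ, IsCoprime m n ∧ |g 1 0 * m + g 1 1 * n| ≤ C / R ∧ |g 0 0 * m + g 0 1 * n| ≤ C * R := by
  set ξ := - g 1 1 / g 1 0 with hξ
  have hξ' : g 1 1 = - (g 1 0 * ξ) := by rw [hξ]; field_simp
  refine ⟨1 + |g 1 0| + |g 0 0| * (|ξ| + 1) + |g 0 1|, ?_, fun R hR => ?_⟩
  · have : 0 ≤ |g 1 0| + |g 0 0| * (|ξ| + 1) + |g 0 1| := by positivity
    linarith
  have hR0 : 0 < R := by linarith
  obtain ⟨j, k, hk0, hk, hjk⟩ := Real.exists_int_int_abs_mul_sub_le ξ (Nat.floor_pos.2 hR)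
  have hkR : (k : ℝ) ≤ R := by
    have : (k : ℝ) ≤ ((⌊R⌋₊ : ℤ) : ℝ) := by exact_mod_cast hk
    refine this.trans ?_
    push_cast
    exact Nat.floor_le hR0.le
  have hk0' : (0:ℝ) < k := by exact_mod_cast hk0
  have hfl : R ≤ (⌊R⌋₊ : ℝ) + 1 := (Nat.lt_floor_add_one R).le
  have hjk' : |k * ξ - j| ≤ 1 / R := hjk.trans (by gcongr)
  have hj : |(j : ℝ)| ≤ R * (|ξ| + 1) := by
    have e : (j : ℝ) = k * ξ - (k * ξ - j) := by ring
    have h1 : |(j : ℝ)| ≤ |k * ξ| + |k * ξ - j| := by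
      conv_lhs => rw [e]
      exact abs_sub _ _
    have h2 : 1 / R ≤ R := by rw [div_le_iff₀ hR0]; nlinarith
    rw [abs_mul, abs_of_pos hk0'] at h1
    have h3 : k * |ξ| ≤ R * |ξ| := by gcongr
    linarith
  have hy : |g 1 0 * j + g 1 1 * k| ≤ |g 1 0| / R := by
    have : g 1 0 * j + g 1 1 * k = - (g 1 0 * (k * ξ - j)) := by rw [hξ']; ring
    rw [this, abs_neg, abs_mul]
    calc _ ≤ |g 1 0| * (1 / R) := by gcongr
      _ = _ := by ring
  have hx : |g 0 0 * j + g 0 1 * k| ≤ (|g 0 0| * (|ξ| + 1) + |g 0 1|) * R := by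
    refine (abs_add_le _ _).trans ?_
    rw [abs_mul, abs_mul, abs_of_pos hk0']
    calc _ ≤ |g 0 0| * (R * (|ξ| + 1)) + |g 0 1| * R := by gcongr
      _ = _ := by ring
  obtain ⟨d, m, n, hd, hco, hm, hn⟩ := Int.exists_gcd_one' (m := j) (n := k)
    (Int.gcd_pos_of_ne_zero_right _ hk0.ne')
  have hd' : (1:ℝ) ≤ d := by exact_mod_cast hd
  refine ⟨m, n, Int.isCoprime_iff_gcd_eq_one.2 hco, ?_, ?_⟩
  · have e : |g 1 0 * j + g 1 1 * k| = d * |g 1 0 * m + g 1 1 * n| := by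
      rw [hm, hn]; push_cast
      rw [show g 1 0 * (m * d) + g 1 1 * (n * d) = d * (g 1 0 * m + g 1 1 * n) by ring, abs_mul,
        abs_of_pos (by linarith : (0:ℝ) < d)]
    calc |g 1 0 * m + g 1 1 * n| ≤ d * |g 1 0 * m + g 1 1 * n| := by
          nlinarith [abs_nonneg (g 1 0 * m + g 1 1 * n)]
      _ ≤ |g 1 0| / R := by rw [← e]; exact hy
      _ ≤ _ := by
        gcongr
        have : 0 ≤ |g 0 0| * (|ξ| + 1) + |g 0 1| := by positivity
        linarith
  · have e : |g 0 0 * j + g 0 1 * k| = d * |g 0 0 * m + g 0 1 * n| := by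
      rw [hm, hn]; push_cast
      rw [show g 0 0 * (m * d) + g 0 1 * (n * d) = d * (g 0 0 * m + g 0 1 * n) by ring, abs_mul,
        abs_of_pos (by linarith : (0:ℝ) < d)]
    calc |g 0 0 * m + g 0 1 * n| ≤ d * |g 0 0 * m + g 0 1 * n| := by
          nlinarith [abs_nonneg (g 0 0 * m + g 0 1 * n)]
      _ ≤ (|g 0 0| * (|ξ| + 1) + |g 0 1|) * R := by rw [← e]; exact hx
      _ ≤ _ := by
        gcongr
        have : 0 ≤ |g 1 0| := by positivity
        linarith

lemma X_large (g : GG) (hnp : ∀ m n : ℤ, IsCoprime m n → g 1 0 * m + g 1 1 * n ≠ 0) (L : ℝ) :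
    ∀ᶠ T : ℝ in atTop, ∀ m n : ℤ, IsCoprime m n →
      L ≤ |g 0 0 * m + g 0 1 * n| + T * |g 1 0 * m + g 1 1 * n| := by
  set B : ℤ := ⌈(|g 0 0| + |g 0 1| + |g 1 0| + |g 1 1|) * |L|⌉ with hB
  have hfin : ∀ᶠ T : ℝ in atTop, ∀ z ∈ Finset.Icc (-B) B ×ˢ Finset.Icc (-B) B,
      IsCoprime z.1 z.2 → L ≤ T * |g 1 0 * z.1 + g 1 1 * z.2| := by
    rw [Filter.eventually_all_finset]
    rintro ⟨m, n⟩ _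
    by_cases h : IsCoprime m n
    · have hp := abs_pos.2 (hnp m n h)
      filter_upwards [eventually_ge_atTop (L / |g 1 0 * m + g 1 1 * n|)] with T hT _
      rwa [div_le_iff₀ hp] at hT
    · exact Eventually.of_forall fun T h' => absurd h' h
  filter_upwards [hfin, eventually_ge_atTop 1] with T hT hT1 m n hco
  by_contra! hlt
  set x := g 0 0 * m + g 0 1 * n with hx
  set y := g 1 0 * m + g 1 1 * n with hy
  have hd := det_GG g
  have hm : (m : ℝ) = g 1 1 * x - g 0 1 * y := by
    rw [hx, hy]; linear_combination -(m : ℝ) * hd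
  have hn : (n : ℝ) = g 0 0 * y - g 1 0 * x := by
    rw [hx, hy]; linear_combination -(n : ℝ) * hd
  have hy0 := abs_nonneg y
  have hx0 := abs_nonneg x
  have hLL := le_abs_self L
  have hyT : |y| ≤ T * |y| := by nlinarith
  have bx : |x| ≤ |L| := by linarith
  have hyl : |y| ≤ |L| := by linarith
  have hceil : (|g 0 0| + |g 0 1| + |g 1 0| + |g 1 1|) * |L| ≤ B := Int.le_ceil _
  have p1 : |(m : ℝ)| ≤ B := by
    rw [hm]
    refine (abs_sub _ _).trans (le_trans ?_ hceil)
    rw [abs_mul, abs_mul]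
    have e1 : |g 1 1| * |x| ≤ |g 1 1| * |L| := by gcongr
    have e2 : |g 0 1| * |y| ≤ |g 0 1| * |L| := by gcongr
    have e3 : 0 ≤ (|g 0 0| + |g 1 0|) * |L| := by positivity
    linarith
  have p2 : |(n : ℝ)| ≤ B := by
    rw [hn]
    refine (abs_sub _ _).trans (le_trans ?_ hceil)
    rw [abs_mul, abs_mul]
    have e1 : |g 1 0| * |x| ≤ |g 1 0| * |L| := by gcongr
    have e2 : |g 0 0| * |y| ≤ |g 0 0| * |L| := by gcongr
    have e3 : 0 ≤ (|g 0 1| + |g 1 1|) * |L| := by positivity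
    linarith
  have q1 : |m| ≤ B := by exact_mod_cast p1
  have q2 : |n| ≤ B := by exact_mod_cast p2
  have := hT (m, n) (by
    rw [Finset.mem_product, Finset.mem_Icc, Finset.mem_Icc]
    exact ⟨abs_le.1 q1, abs_le.1 q2⟩) hco
  have h2 : L ≤ T * |y| := this
  linarith

/-- image of bounded matrices -/
def KB (B : ℝ) : Set XX := (fun g : GG => (g : XX)) '' {g | ∀ i j, (g i j) ^ 2 ≤ B}

lemma KB_compact (B : ℝ) : IsCompact (KB B) := by
  apply IsCompact.image _ QuotientGroup.continuous_mk
  have h1 : IsCompact {A : Fin 2 → Fin 2 → ℝ | ∀ i j, A i j ∈ Set.Icc (-(|B| + 1)) (|B| + 1)} := by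
    have := isCompact_univ_pi (ι := Fin 2) (s := fun _ => Set.pi Set.univ fun _ : Fin 2 =>
      Set.Icc (-(|B| + 1)) (|B| + 1)) (fun _ => isCompact_univ_pi fun _ => isCompact_Icc)
    convert this using 1
    ext A
    exact ⟨fun h i _ j _ => h i j, fun h i j => h i trivial j trivial⟩
  have h2 := val_isClosedEmbedding.isCompact_preimage h1
  refine h2.of_isClosed_subset ?_ ?_
  · have : {g : GG | ∀ i j, (g i j) ^ 2 ≤ B} = ⋂ i, ⋂ j, {g : GG | (g i j) ^ 2 ≤ B} := by
      ext g; simp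
    rw [this]
    exact isClosed_iInter fun i => isClosed_iInter fun j =>
      isClosed_le ((continuous_entry i j).pow 2) continuous_const
  · intro g hg i j
    have h := hg i j
    have := le_abs_self B
    have h0 := abs_nonneg B
    show g i j ∈ _
    constructor <;> nlinarith

lemma mem_KB (h : GG) (a b : ℝ) (ha : 0 < a) (h1 : a ≤ (h 0 0) ^ 2) (h2 : (h 0 0) ^ 2 ≤ b)
    (h3 : (h 1 0) ^ 2 ≤ b) : (h : XX) ∈ KB (b + 2 * (1 + b ^ 2) / a) := by
  have hv : h 0 0 ≠ 0 := by
    intro h0; rw [h0] at h1; norm_num at h1; linarith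
  have hb : 0 < b := by linarith
  set k : ℤ := - round (h 0 1 / h 0 0) with hk
  have hp : (h 0 0 * k + h 0 1) ^ 2 ≤ b := by
    have hr := abs_sub_round (h 0 1 / h 0 0)
    have e : h 0 0 * k + h 0 1 = h 0 0 * (h 0 1 / h 0 0 - round (h 0 1 / h 0 0)) := by
      rw [hk]; push_cast; field_simp; ring
    rw [e, mul_pow]
    have : (h 0 1 / h 0 0 - round (h 0 1 / h 0 0)) ^ 2 ≤ 1 := by
      rw [sq_le_one_iff_abs_le_one]; linarith
    nlinarith [sq_nonneg (h 0 0)]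
  have hpos : 0 < 2 * (1 + b ^ 2) / a := by positivity
  refine ⟨h * horocycle k, ?_, mk_mul_mem _ _ (horo_one_mem k)⟩
  have hd := det_GG (h * horocycle k)
  have e00 : (h * horocycle k) 0 0 = h 0 0 := by
    simp only [mul00, horo_eq, mat00, mat10]; ring
  have e10 : (h * horocycle k) 1 0 = h 1 0 := by
    simp only [mul10, horo_eq, mat00, mat10]; ring
  have e01 : (h * horocycle k) 0 1 = h 0 0 * k + h 0 1 := by
    simp only [mul01, horo_eq, mat01, mat11]; ring
  rw [e00, e10, e01] at hd
  set q := (h * horocycle k) 1 1 with hq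
  set p := h 0 0 * k + h 0 1 with hpd
  have hqq : q ^ 2 ≤ 2 * (1 + b ^ 2) / a := by
    rw [le_div_iff₀ ha]
    have e : q * h 0 0 = 1 + p * h 1 0 := by linarith
    have e1 : q ^ 2 * a ≤ q ^ 2 * (h 0 0) ^ 2 := by gcongr
    have e2 : q ^ 2 * (h 0 0) ^ 2 = (1 + p * h 1 0) ^ 2 := by rw [← e]; ring
    have e3 : p ^ 2 * (h 1 0) ^ 2 ≤ b * b := by gcongr
    nlinarith [sq_nonneg (1 - p * h 1 0)]
  intro i j
  fin_cases i <;> fin_cases j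
  · show ((h * horocycle k) 0 0) ^ 2 ≤ _
    rw [e00]; linarith
  · show ((h * horocycle k) 0 1) ^ 2 ≤ _
    rw [e01]; linarith
  · show ((h * horocycle k) 1 0) ^ 2 ≤ _
    rw [e10]; linarith
  · show q ^ 2 ≤ _
    linarith

lemma smooth_avg (F : ℝ → ℝ) (hF : Continuous F) (M : ℝ) (hM : ∀ x, |F x| ≤ M) (N T : ℝ)
    (hN : 0 ≤ N) :
    |(∫ t in (0:ℝ)..T, F t) - ∫ t in (0:ℝ)..T, ∫ r in (0:ℝ)..1, F (N * r + t)| ≤ 2 * M * N := by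
  have hM0 : 0 ≤ M := (abs_nonneg _).trans (hM 0)
  have hi : ∀ a b, IntervalIntegrable F volume a b := fun a b => hF.intervalIntegrable a b
  have hc : Continuous (Function.uncurry fun t r => F (N * r + t)) :=
    hF.comp ((continuous_const.mul continuous_snd).add continuous_fst)
  rw [intervalIntegral_intervalIntegral_swap]
  swap
  · refine (hc.continuousOn.integrableOn_compact
      (isCompact_uIcc.prod isCompact_uIcc)).mono_set
      (Set.prod_mono Set.uIoc_subset_uIcc Set.uIoc_subset_uIcc)
  have hcr : Continuous fun r => ∫ t in (0:ℝ)..T, F (N * r + t) := by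
    apply intervalIntegral.continuous_parametric_intervalIntegral_of_continuous'
    exact hF.comp ((continuous_const.mul continuous_fst).add continuous_snd)
  have e1 : (∫ t in (0:ℝ)..T, F t) = ∫ r in (0:ℝ)..1, (∫ t in (0:ℝ)..T, F t) := by simp
  rw [e1, ← intervalIntegral.integral_sub (by simp) (hcr.intervalIntegrable _ _)]
  have := intervalIntegral.norm_integral_le_of_norm_le_const (a := 0) (b := 1)
    (f := fun r => (∫ t in (0:ℝ)..T, F t) - ∫ t in (0:ℝ)..T, F (N * r + t)) (C := 2 * M * N) ?_
  · simpa using this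
  · intro r hr
    rw [Set.uIoc_of_le zero_le_one] at hr
    rw [intervalIntegral.integral_comp_add_left (fun t => F t) (N * r), add_zero]
    have h1 := intervalIntegral.integral_add_adjacent_intervals (hi 0 (N * r)) (hi (N * r) (N * r + T))
    have h2 := intervalIntegral.integral_add_adjacent_intervals (hi 0 T) (hi T (N * r + T))
    have e : (∫ t in (0:ℝ)..T, F t) - (∫ t in (N * r)..(N * r + T), F t)
        = (∫ t in (0:ℝ)..(N * r), F t) - ∫ t in T..(N * r + T), F t := by linarith
    have b1 : |∫ t in (0:ℝ)..(N * r), F t| ≤ M * |N * r - 0| := by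
      simpa only [Real.norm_eq_abs] using
        intervalIntegral.norm_integral_le_of_norm_le_const (f := F) (C := M) (fun x _ => hM x)
    have b2 : |∫ t in T..(N * r + T), F t| ≤ M * |N * r + T - T| := by
      simpa only [Real.norm_eq_abs] using
        intervalIntegral.norm_integral_le_of_norm_le_const (f := F) (C := M) (fun x _ => hM x)
    have hNr : 0 ≤ N * r := mul_nonneg hN hr.1.le
    have hNr' : N * r ≤ N := by nlinarith [hr.2]
    rw [sub_zero, abs_of_nonneg hNr] at b1
    rw [add_sub_cancel_right, abs_of_nonneg hNr] at b2
    rw [e, Real.norm_eq_abs]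
    refine (abs_sub _ _).trans ?_
    have : M * (N * r) ≤ M * N := by gcongr
    linarith

lemma bad_set_bound (H : ℝ → ℝ) (hH : Continuous H) (M ε V T : ℝ) (hM : ∀ x, |H x| ≤ M)
    (hε : 0 ≤ ε) (hT : 0 ≤ T) (hV : 0 ≤ V)
    (S : Set ℝ) (hS : MeasurableSet S) (hSV : volume S ≤ ENNReal.ofReal V)
    (hgood : ∀ t ∈ Set.Icc 0 T, t ∉ S → |H t| ≤ ε) :
    |∫ t in (0:ℝ)..T, H t| ≤ ε * T + M * V := by
  have hM0 : 0 ≤ M := (abs_nonneg _).trans (hM 0)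
  have h1 : |∫ t in (0:ℝ)..T, H t| ≤ ∫ t in (0:ℝ)..T, |H t| :=
    intervalIntegral.abs_integral_le_integral_abs hT
  refine h1.trans ?_
  rw [intervalIntegral.integral_of_le hT]
  have hSfin : volume S ≠ ⊤ := (hSV.trans_lt ENNReal.ofReal_lt_top).ne
  have hind : Integrable (S.indicator fun _ => M) (volume.restrict (Set.Ioc 0 T)) :=
    (integrable_const M).indicator hS
  have h2 : ∫ t in Set.Ioc 0 T, |H t| ≤ ∫ t in Set.Ioc 0 T, (ε + S.indicator (fun _ => M) t) := by
    refine setIntegral_mono_on ?_ ((integrable_const ε).add hind) measurableSet_Ioc ?_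
    · exact (hH.abs.integrableOn_Icc).mono_set Set.Ioc_subset_Icc_self
    · intro t ht
      by_cases hts : t ∈ S
      · rw [Set.indicator_of_mem hts]
        have := hM t
        linarith
      · rw [Set.indicator_of_notMem hts, add_zero]
        exact hgood t ⟨ht.1.le, ht.2⟩ hts
  refine h2.trans ?_
  rw [integral_add (integrable_const ε) hind, integral_indicator hS, setIntegral_const,
    setIntegral_const]
  have h3 : (volume.restrict (Set.Ioc 0 T)).real S ≤ V := by
    rw [measureReal_def]
    apply ENNReal.toReal_le_of_le_ofReal hV
    exact (Measure.restrict_apply_le _ _).trans hSV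
  rw [Real.volume_real_Ioc_of_le hT, smul_eq_mul, smul_eq_mul]
  nlinarith

lemma bad_volume (x y T δ : ℝ) (hT : 0 < T) (hδ : 0 < δ) (hδ3 : δ ≤ 1/3) (hX : 0 < |x| + T * |y|) :
    volume {t : ℝ | t ∈ Set.Icc 0 T ∧ |x + t * y| < δ * (|x| + T * |y|)} ≤
      ENNReal.ofReal (6 * δ * T) := by
  set X := |x| + T * |y| with hXd
  by_cases hy : T * |y| < X / 3
  · have : {t : ℝ | t ∈ Set.Icc 0 T ∧ |x + t * y| < δ * X} = ∅ := by
      ext t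
      simp only [Set.mem_ofPred_eq, Set.mem_empty_iff_false, iff_false, not_and, not_lt]
      intro ht
      have h1 : |x| ≤ |x + t * y| + |t * y| := by
        have := abs_sub (x + t * y) (t * y)
        rwa [add_sub_cancel_right] at this
      rw [abs_mul, abs_of_nonneg ht.1] at h1
      have h2 : t * |y| ≤ T * |y| := by gcongr; exact ht.2
      nlinarith
    rw [this]; simp
  · push Not at hy
    have hy0 : 0 < |y| := by
      by_contra h
      have : |y| = 0 := le_antisymm (not_lt.1 h) (abs_nonneg y)
      rw [this] at hy; linarith
    have hyne : y ≠ 0 := abs_pos.1 hy0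
    have hsub : {t : ℝ | t ∈ Set.Icc 0 T ∧ |x + t * y| < δ * X} ⊆
        Set.Ioo (-x / y - δ * X / |y|) (-x / y + δ * X / |y|) := by
      rintro t ⟨_, ht⟩
      have e : x + t * y = y * (t - (-x / y)) := by field_simp; ring
      rw [e, abs_mul, mul_comm, ← lt_div_iff₀ hy0, abs_lt] at ht
      constructor <;> linarith [ht.1, ht.2]
    refine (measure_mono hsub).trans ?_
    rw [Real.volume_Ioo]
    apply ENNReal.ofReal_le_ofReal
    have : δ * X / |y| ≤ 3 * δ * T := by
      rw [div_le_iff₀ hy0]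
      nlinarith
    linarith

lemma continuous_orbit (x : XX) : Continuous fun t : ℝ => horocycle t • x :=
  continuous_horocycle.smul continuous_const

set_option maxHeartbeats 2000000 in
lemma core [BorelSpace XX] (ν : Measure XX) [IsProbabilityMeasure ν]
    [SMulInvariantMeasure GG XX ν] (f : XX → ℝ) (hf : Continuous f) (hfc : HasCompactSupport f)
    (M : ℝ) (hM : ∀ x, |f x| ≤ M) (g : GG)
    (ha : ∀ t : ℝ, 0 < t → horocycle t • (g : XX) ≠ (g : XX)) (ε : ℝ) (hε : 0 < ε)
    (hε3 : ε ≤ 1/3) :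
    ∀ᶠ T : ℝ in atTop, |(1 / T) * (∫ t in (0:ℝ)..T, f (horocycle t • (g : XX))) - ∫ x, f x ∂ν| ≤
      (14 * M + 1) * ε := by
  have hnp := nonper g ha
  have hg10 : g 1 0 ≠ 0 := by
    have := hnp 1 0 isCoprime_one_left
    simpa using this
  obtain ⟨C, hC1, hdir⟩ := dirichlet g hg10
  have hC0 : 0 < C := by linarith
  set c := ε / (4 * C ^ 2) with hc
  have hc0 : 0 < c := by positivity
  have hcC : c * (4 * C ^ 2) = ε := by rw [hc]; field_simp
  set a1 := ε ^ 2 / c with ha1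
  have ha10 : 0 < a1 := by positivity
  set b := 2 / c + 4 * c * C ^ 4 with hb
  obtain ⟨n0, hn0⟩ := eventually_atTop.1 (Ev_uniform ν f hf hfc (KB (b + 2 * (1 + b ^ 2) / a1))
    (KB_compact _) ε hε)
  set c0 := ∫ x, f x ∂ν with hc0d
  have hc0M : |c0| ≤ M := by
    have := norm_integral_le_of_norm_le_const (μ := ν) (f := f) (C := M)
      (Eventually.of_forall fun x => hM x)
    simpa using this
  have hM0 : 0 ≤ M := (abs_nonneg _).trans hc0M
  set L : ℝ := 1 + (n0 + 2) / c with hL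
  have hL1 : 1 ≤ L := by
    have : 0 ≤ (n0 + 2) / c := by positivity
    linarith
  have hLc : (n0 + 2 : ℝ) ≤ c * L := by
    have : c * L = c + (n0 + 2) := by rw [hL]; field_simp
    linarith
  filter_upwards [X_large g hnp L, eventually_ge_atTop 1] with T hXL hT1
  have hT0 : 0 < T := by linarith
  set R := √T with hR
  have hR1 : 1 ≤ R := by rw [hR]; exact Real.one_le_sqrt.2 hT1
  have hRR : R * R = T := Real.mul_self_sqrt hT0.le
  have hR0 : 0 < R := by linarith
  obtain ⟨m, n, hco, hyC, hxC⟩ := hdir R hR1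
  have hXL := hXL m n hco
  obtain ⟨γ, hγ, hγ0, hγ1⟩ := exists_completion m n hco
  have hgx : (g * γ) 0 0 = g 0 0 * m + g 0 1 * n := by rw [mul00, hγ0, hγ1]
  have hgy : (g * γ) 1 0 = g 1 0 * m + g 1 1 * n := by rw [mul10, hγ0, hγ1]
  rw [← hgx] at hxC hXL
  rw [← hgy] at hyC hXL
  have hgm : (g : XX) = ((g * γ : GG) : XX) := (mk_mul_mem g γ hγ).symm
  rw [hgm]
  set k := g * γ with hk
  set x := k 0 0 with hx
  set y := k 1 0 with hy
  set X := |x| + T * |y| with hX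
  rw [le_div_iff₀ hR0] at hyC
  have hX0 : 0 < X := by linarith
  have hy0 := abs_nonneg y
  have hx0 := abs_nonneg x
  have hX2 : X ≤ 2 * C * R := by
    have : T * |y| = R * (|y| * R) := by rw [← hRR]; ring
    have h2 : R * (|y| * R) ≤ R * C := by gcongr
    linarith
  have hXX : X ^ 2 ≤ 4 * C ^ 2 * T := by
    calc X ^ 2 ≤ (2 * C * R) ^ 2 := by gcongr
      _ = _ := by rw [← hRR]; ring
  have hTy : T * y ^ 2 ≤ C ^ 2 := by
    have : T * y ^ 2 = (|y| * R) ^ 2 := by rw [mul_pow, sq_abs, ← hRR]; ring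
    rw [this]
    gcongr
  have hcX : (n0 + 2 : ℝ) ≤ c * X ^ 2 := by
    refine hLc.trans ?_
    gcongr
    nlinarith
  have hcX0 : 0 ≤ c * X ^ 2 := by positivity
  set N := ⌊c * X ^ 2⌋₊ with hN
  have hN1 : (N : ℝ) ≤ c * X ^ 2 := Nat.floor_le hcX0
  have hN2 : c * X ^ 2 < N + 1 := Nat.lt_floor_add_one _
  have hn0' : (0:ℝ) ≤ n0 := Nat.cast_nonneg _
  have hN3 : c * X ^ 2 / 2 ≤ N := by linarith
  have hNpos' : (0:ℝ) < N := by linarith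
  have hNpos : 0 < N := by exact_mod_cast hNpos'
  have hNn0 : n0 ≤ N := by
    have : (n0 : ℝ) ≤ N := by linarith
    exact_mod_cast this
  have hNT : (N : ℝ) ≤ ε * T := by
    calc (N : ℝ) ≤ c * X ^ 2 := hN1
      _ ≤ c * (4 * C ^ 2 * T) := by gcongr
      _ = ε * T := by rw [← hcC]; ring
  have hunif := hn0 N hNn0
  set F : ℝ → ℝ := fun t => f (horocycle t • (k : XX)) with hF
  have hhc : Continuous fun t : ℝ => horocycle t • (k : XX) := continuous_orbit _
  have hFc : Continuous F := hf.comp hhc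
  have hsm := smooth_avg F hFc M (fun _ => hM _) N T hNpos'.le
  have hB : ∀ t, (∫ r in (0:ℝ)..1, F (N * r + t)) = Av f N (horocycle t • (k : XX)) := by
    intro t
    unfold Av
    congr 1
    ext r
    rw [hF]
    simp only [horo_add, mul_smul]
  simp_rw [hB] at hsm
  have hAc : Continuous fun t => Av f N (horocycle t • (k : XX)) :=
    (continuous_Av f hf N).comp (continuous_orbit _)
  have hexp : Real.exp (-tn N) ^ 2 * N = 1 := by
    rw [← exp_tn N hNpos, exp_two_mul']
    have := exp_mul_neg (tn N)
    linear_combination (Real.exp (tn N) * Real.exp (-tn N) + 1) * this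
  have hexp2 : Real.exp (tn N) ^ 2 = N := by
    rw [← exp_tn N hNpos, exp_two_mul']; ring
  have hgood : ∀ t ∈ Set.Icc 0 T, t ∉ {t : ℝ | t ∈ Set.Icc 0 T ∧ |x + t * y| < ε * X} →
      |Av f N (horocycle t • (k : XX)) - c0| ≤ ε := by
    intro t ht hts
    have hge : ε * X ≤ |x + t * y| := by
      by_contra h
      exact hts ⟨ht, not_le.1 h⟩
    have hle : |x + t * y| ≤ X := by
      refine (abs_add_le _ _).trans ?_
      rw [abs_mul, abs_of_nonneg ht.1, hX]
      gcongr
      exact ht.2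
    have hmem := mem_KB (dg (-tn N) * (horocycle t * k)) a1 b ha10
    have e00 : (dg (-tn N) * (horocycle t * k)) 0 0 = Real.exp (-tn N) * (x + t * y) := by
      simp only [mul00, mul10, dg, horo_eq, mat00, mat01, mat10, mat11, ← hx, ← hy]; ring
    have e10 : (dg (-tn N) * (horocycle t * k)) 1 0 = Real.exp (tn N) * y := by
      simp only [mul00, mul10, dg, horo_eq, mat00, mat01, mat10, mat11, ← hx, ← hy, neg_neg]; ring
    have hv : (Real.exp (-tn N) * (x + t * y)) ^ 2 = (x + t * y) ^ 2 / N := by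
      rw [eq_div_iff hNpos'.ne', mul_pow]
      linear_combination (x + t * y) ^ 2 * hexp
    have hu : (Real.exp (tn N) * y) ^ 2 = N * y ^ 2 := by
      rw [mul_pow, hexp2]
    have s1 : (ε * X) ^ 2 ≤ (x + t * y) ^ 2 := by
      rw [← sq_abs (x + t * y)]; gcongr
    have s2 : (x + t * y) ^ 2 ≤ X ^ 2 := by
      rw [← sq_abs (x + t * y)]; gcongr
    rw [e00, e10, hv, hu] at hmem
    have hmem := hmem (by
        rw [ha1, div_le_div_iff₀ hc0 hNpos']
        calc ε ^ 2 * N ≤ ε ^ 2 * (c * X ^ 2) := by gcongr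
          _ = (ε * X) ^ 2 * c := by ring
          _ ≤ _ := by gcongr) (by
        have : (x + t * y) ^ 2 / N ≤ 2 / c := by
          rw [div_le_div_iff₀ hNpos' hc0]
          calc (x + t * y) ^ 2 * c ≤ X ^ 2 * c := by gcongr
            _ ≤ _ := by linarith
        have h4 : 0 ≤ 4 * c * C ^ 4 := by positivity
        linarith) (by
        have : N * y ^ 2 ≤ 4 * c * C ^ 4 := by
          calc N * y ^ 2 ≤ (c * (4 * C ^ 2 * T)) * y ^ 2 := by
                gcongr
                exact hN1.trans (by gcongr)
            _ = 4 * c * C ^ 2 * (T * y ^ 2) := by ring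
            _ ≤ 4 * c * C ^ 2 * C ^ 2 := by gcongr
            _ = _ := by ring
        have h4 : 0 ≤ 2 / c := by positivity
        linarith)
    have hu := hunif _ hmem
    rw [Ev_tn f N hNpos] at hu
    have e : dg (tn N) • ((dg (-tn N) * (horocycle t * k) : GG) : XX) = horocycle t • (k : XX) := by
      show ((dg (tn N) * (dg (-tn N) * (horocycle t * k)) : GG) : XX) = ((horocycle t * k : GG) : XX)
      rw [← mul_assoc, dg_mul_neg, one_mul]
    rw [e] at hu
    exact hu
  have hbad := bad_set_bound (fun t => Av f N (horocycle t • (k : XX)) - c0)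
    (hAc.sub continuous_const) (2 * M) ε (6 * ε * T) T
    (fun t => by
      refine (abs_sub _ _).trans ?_
      have := Av_bound f M hM N (horocycle t • (k : XX))
      linarith) hε.le hT0.le (by positivity)
    {t : ℝ | t ∈ Set.Icc 0 T ∧ |x + t * y| < ε * X}
    (by
      have h1 : MeasurableSet {t : ℝ | |x + t * y| < ε * X} :=
        (isOpen_lt (by fun_prop) continuous_const).measurableSet
      exact measurableSet_Icc.inter h1)
    (bad_volume x y T ε hT0 hε hε3 hX0) hgood
  rw [intervalIntegral.integral_sub (hAc.intervalIntegrable _ _) (by simp),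
    intervalIntegral.integral_const, smul_eq_mul, sub_zero] at hbad
  have e : (1 / T) * (∫ t in (0:ℝ)..T, F t) - c0 = ((∫ t in (0:ℝ)..T, F t) - T * c0) / T := by
    field_simp
  rw [e, abs_div, abs_of_pos hT0, div_le_iff₀ hT0]
  refine (abs_sub_le _ (∫ t in (0:ℝ)..T, Av f N (horocycle t • (k : XX))) _).trans ?_
  refine (add_le_add hsm hbad).trans ?_
  nlinarith

/-- **Dani**: every nonperiodic horocycle orbit on `SL(2,ℝ)/SL(2,ℤ)` is uniformly
distributed with respect to the `G`-invariant probability measure. -/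
theorem dani_horocycle_equidistribution
    [BorelSpace (SL(2, ℝ) ⧸ SLZ2)]
    (a : SL(2, ℝ) ⧸ SLZ2) (ha : ∀ t : ℝ, 0 < t → horocycle t • a ≠ a)
    (ν : Measure (SL(2, ℝ) ⧸ SLZ2)) [IsProbabilityMeasure ν]
    (hν : ∀ g : SL(2, ℝ), MeasurePreserving (fun x : SL(2, ℝ) ⧸ SLZ2 => g • x) ν ν)
    (f : (SL(2, ℝ) ⧸ SLZ2) → ℝ) (hf : Continuous f) (hfc : HasCompactSupport f) :
    Tendsto (fun T : ℝ => (1 / T) * ∫ t in (0 : ℝ)..T, f (horocycle t • a))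
      atTop (𝓝 (∫ x, f x ∂ν)) := by
  have : SMulInvariantMeasure GG XX ν :=
    ⟨fun c s hs => (hν c).measure_preimage hs.nullMeasurableSet⟩
  obtain ⟨M, hM⟩ := hfc.exists_bound_of_continuous hf
  have hM : ∀ x, |f x| ≤ M := hM
  obtain ⟨g, rfl⟩ := QuotientGroup.mk_surjective a
  have hM0 : 0 ≤ M := (abs_nonneg _).trans (hM (1 : GG))
  rw [Metric.tendsto_nhds]
  intro ε hε
  have hp : 0 < 14 * M + 1 := by linarith
  set η := min (1/3) (ε / (2 * (14 * M + 1))) with hη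
  have hη0 : 0 < η := by rw [hη]; positivity
  have h1 : (14 * M + 1) * η < ε := by
    have : η ≤ ε / (2 * (14 * M + 1)) := min_le_right _ _
    rw [le_div_iff₀ (by positivity)] at this
    nlinarith
  filter_upwards [core ν f hf hfc M hM g ha η hη0 (min_le_left _ _)] with T hT
  rw [Real.dist_eq]
  exact hT.trans_lt h1
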